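/- Suppose f : [−1,1] → ℝ has absolutely continuous derivatives f, f', ..., f^{(k−1)} on [−1,1] and ∫_{−1}^1 |f^{(k+1)}(x)|/√(1−x²) dx ≤ V_k. Let f̂_p be the degree-p truncated Chebyshev expansion of f, i.e. f̂_p(x) = a₀/2 + ∑_{j=1}^p a_j T_j(x) with a_j = (2/π)∫_{−1}^1 f(x)T_j(x)/√(1−x²) dx. Then for p > k, sup_{x∈[−1,1]} |f̂_p(x) − f(x)| ≤ 2V_k / (π k (p−k)^k). -/

import Mathlib

open MeasureTheory Polynomial

/-- Unnormalised cosine coefficient of `g ∘ cos`. -/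
noncomputable def cosCoef (g : ℝ → ℝ) (n : ℕ) : ℝ :=
  ∫ θ in (0:ℝ)..Real.pi, g (Real.cos θ) * Real.cos (n * θ)

lemma cov (h : ℝ → ℝ) :
    ∫ x in Set.Ioo (-1 : ℝ) 1, h x / Real.sqrt (1 - x ^ 2)
      = ∫ θ in (0:ℝ)..Real.pi, h (Real.cos θ) := by
  rw [← Chebyshev.integral_measureT_eq_integral_cos, Chebyshev.integral_measureT,
    intervalIntegral.integral_of_le (by norm_num), integral_Ioc_eq_integral_Ioo]
  simp [div_eq_mul_inv]

lemma cont_comp_cos {g : ℝ → ℝ} (hg : ContinuousOn g (Set.Icc (-1 : ℝ) 1)) :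
    Continuous (fun θ => g (Real.cos θ)) :=
  hg.comp_continuous Real.continuous_cos (fun θ => ⟨Real.neg_one_le_cos θ, Real.cos_le_one θ⟩)

lemma cosCoef_step {g : ℝ → ℝ} (hd : DifferentiableOn ℝ g (Set.Icc (-1 : ℝ) 1))
    (hc : ContinuousOn (derivWithin g (Set.Icc (-1 : ℝ) 1)) (Set.Icc (-1 : ℝ) 1)) (n : ℕ) :
    ((n + 1 : ℕ) : ℝ) * cosCoef g (n + 1) =
      (cosCoef (derivWithin g (Set.Icc (-1 : ℝ) 1)) n -
        cosCoef (derivWithin g (Set.Icc (-1 : ℝ) 1)) (n + 2)) / 2 := by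
  set g' := derivWithin g (Set.Icc (-1 : ℝ) 1) with hg'
  have hcg := cont_comp_cos hd.continuousOn
  have hcg' := cont_comp_cos hc
  have hparts := intervalIntegral.integral_mul_deriv_eq_deriv_mul_of_hasDerivAt
    (a := 0) (b := Real.pi) (u := fun θ => g (Real.cos θ))
    (u' := fun θ => g' (Real.cos θ) * (- Real.sin θ))
    (v := fun θ => Real.sin (((n + 1 : ℕ) : ℝ) * θ))
    (v' := fun θ => Real.cos (((n + 1 : ℕ) : ℝ) * θ) * (((n + 1 : ℕ) : ℝ) * 1))
    hcg.continuousOn (by fun_prop)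
    (by
      intro θ hθ
      rw [min_eq_left Real.pi_pos.le, max_eq_right Real.pi_pos.le] at hθ
      have h1 : Real.cos θ < 1 := by
        rw [← Real.cos_zero]
        exact Real.cos_lt_cos_of_nonneg_of_le_pi le_rfl hθ.2.le hθ.1
      have h2 : -1 < Real.cos θ := by
        rw [← Real.cos_pi]
        exact Real.cos_lt_cos_of_nonneg_of_le_pi hθ.1.le le_rfl hθ.2
      have h3 : HasDerivAt g (g' (Real.cos θ)) (Real.cos θ) :=
        (hd _ ⟨h2.le, h1.le⟩).hasDerivWithinAt.hasDerivAt (Icc_mem_nhds h2 h1)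
      exact h3.comp θ (Real.hasDerivAt_cos θ))
    (by
      intro θ _
      exact ((hasDerivAt_id θ).const_mul _).sin)
    ((hcg'.mul Real.continuous_sin.neg).intervalIntegrable _ _)
    (Continuous.intervalIntegrable (by fun_prop) _ _)
  have e1 : Real.sin (((n + 1 : ℕ) : ℝ) * Real.pi) = 0 := Real.sin_nat_mul_pi _
  simp only [e1, mul_zero, Real.sin_zero, sub_zero, zero_sub, mul_one] at hparts
  have e2 : ((n + 1 : ℕ) : ℝ) * cosCoef g (n + 1) =
      ∫ x in (0:ℝ)..Real.pi, g (Real.cos x) *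
        (Real.cos (((n + 1 : ℕ) : ℝ) * x) * ((n + 1 : ℕ) : ℝ)) := by
    rw [cosCoef, ← intervalIntegral.integral_const_mul]
    congr 1; ext x; ring
  rw [e2, hparts, cosCoef, cosCoef, ← intervalIntegral.integral_sub, ← intervalIntegral.integral_neg,
    ← intervalIntegral.integral_div]
  · congr 1; ext x
    have a1 : ((n : ℕ) : ℝ) * x = ((n + 1 : ℕ) : ℝ) * x - x := by push_cast; ring
    have a2 : ((n + 2 : ℕ) : ℝ) * x = ((n + 1 : ℕ) : ℝ) * x + x := by push_cast; ring
    rw [a1, a2, Real.cos_sub, Real.cos_add]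
    ring
  · exact (hcg'.mul (by fun_prop)).intervalIntegrable _ _
  · exact (hcg'.mul (by fun_prop)).intervalIntegrable _ _

lemma cosCoef_bound (m : ℕ) : ∀ (g : ℝ → ℝ), ContDiffOn ℝ m g (Set.Icc (-1 : ℝ) 1) →
    ∀ n : ℕ, m ≤ n → |cosCoef g n| ≤
      (∫ θ in (0:ℝ)..Real.pi, |iteratedDerivWithin m g (Set.Icc (-1 : ℝ) 1) (Real.cos θ)|) /
        (n.descFactorial m : ℝ) := by
  induction m with
  | zero =>
    intro g hg n _
    simp only [iteratedDerivWithin_zero, Nat.descFactorial_zero, Nat.cast_one, div_one]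
    have hc := cont_comp_cos hg.continuousOn
    refine (intervalIntegral.abs_integral_le_integral_abs Real.pi_pos.le).trans ?_
    refine intervalIntegral.integral_mono_on Real.pi_pos.le
      ((hc.mul (by fun_prop)).abs.intervalIntegrable _ _) (hc.abs.intervalIntegrable _ _) ?_
    intro θ _
    rw [abs_mul]
    exact mul_le_of_le_one_right (abs_nonneg _) (Real.abs_cos_le_one _)
  | succ m ih =>
    intro g hg n hn
    obtain ⟨n, rfl⟩ : ∃ j, n = j + 1 := ⟨n - 1, by omega⟩
    have hu : UniqueDiffOn ℝ (Set.Icc (-1 : ℝ) 1) := uniqueDiffOn_Icc (by norm_num)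
    have hg2 := hg
    rw [Nat.cast_succ, contDiffOn_succ_iff_derivWithin hu] at hg2
    obtain ⟨hd, -, hg'⟩ := hg2
    have hstep := cosCoef_step hd hg'.continuousOn n
    have b1 := ih _ hg' n (by omega)
    have b2 := ih _ hg' (n + 2) (by omega)
    rw [iteratedDerivWithin_succ']
    set W := ∫ θ in (0:ℝ)..Real.pi, |iteratedDerivWithin m (derivWithin g (Set.Icc (-1 : ℝ) 1))
      (Set.Icc (-1 : ℝ) 1) (Real.cos θ)| with hW
    have hW0 : 0 ≤ W := intervalIntegral.integral_nonneg Real.pi_pos.le (fun _ _ => abs_nonneg _)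
    have hpos : (0:ℝ) < n.descFactorial m := by
      exact_mod_cast Nat.descFactorial_pos.2 (by omega)
    have hle : (n.descFactorial m : ℝ) ≤ (n + 2).descFactorial m := by
      exact_mod_cast Nat.descFactorial_le m (by omega)
    have b3 : W / ((n + 2).descFactorial m : ℝ) ≤ W / (n.descFactorial m : ℝ) := by gcongr
    rw [Nat.succ_descFactorial_succ, Nat.cast_mul]
    have hn0 : (0:ℝ) < ((n + 1 : ℕ) : ℝ) := by positivity
    rw [mul_comm, ← div_div, le_div_iff₀ hn0, ← abs_of_pos hn0, ← abs_mul, mul_comm, hstep,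
      abs_div, abs_two]
    have := abs_sub (cosCoef (derivWithin g (Set.Icc (-1 : ℝ) 1)) n)
      (cosCoef (derivWithin g (Set.Icc (-1 : ℝ) 1)) (n + 2))
    linarith

lemma telescoping (k p : ℕ) (hk : 1 ≤ k) (hkp : k ≤ p) (N : ℕ) :
    ∑ i ∈ Finset.range N, 1 / ((i + (p + 1)).descFactorial (k + 1) : ℝ) =
      1 / (k * (p.descFactorial k : ℝ)) - 1 / (k * ((p + N).descFactorial k : ℝ)) := by
  induction N with
  | zero => simp
  | succ N ih =>
    rw [Finset.sum_range_succ, ih, show N + (p + 1) = (p + N) + 1 by ring,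
      show p + (N + 1) = (p + N) + 1 by ring]
    have h1 := Nat.succ_descFactorial_succ (p + N) k
    have h2 := Nat.succ_descFactorial (p + N) k
    have h3 : (0:ℝ) < (p + N).descFactorial k := by
      exact_mod_cast Nat.descFactorial_pos.2 (by omega)
    have h4 : (0:ℝ) < (p + N + 1).descFactorial k := by
      exact_mod_cast Nat.descFactorial_pos.2 (by omega)
    have h2' : ((p:ℝ) + N + 1 - k) * (p + N + 1).descFactorial k =
        (p + N + 1) * (p + N).descFactorial k := by
      have : ((p + N + 1 - k : ℕ) : ℝ) = (p:ℝ) + N + 1 - k := by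
        rw [Nat.cast_sub (by omega)]; push_cast; ring
      rw [← this]; exact_mod_cast h2
    rw [h1]
    push_cast
    have hk0 : (0:ℝ) < k := by exact_mod_cast hk
    have h5 : (0:ℝ) < (p:ℝ) + N + 1 := by positivity
    field_simp
    linear_combination (-1 : ℝ) * h2'

lemma cosCoef_hasSum {f : ℝ → ℝ} (hf : ContinuousOn f (Set.Icc (-1 : ℝ) 1))
    (hs : Summable (cosCoef f)) (θ : ℝ) :
    HasSum (fun n : ℕ => (2 / Real.pi) * cosCoef f n * Real.cos (n * θ))
      (f (Real.cos θ) + (1 / Real.pi) * cosCoef f 0) := by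
  have : Fact (0 < 2 * Real.pi) := ⟨Real.two_pi_pos⟩
  have hcf := cont_comp_cos hf
  have hper : Function.Periodic (fun x : ℝ => ((f (Real.cos x) : ℝ) : ℂ)) (2 * Real.pi) := by
    intro x; simp
  have hG : Continuous hper.lift :=
    continuous_coinduced_dom.2 (Complex.continuous_ofReal.comp hcf)
  let G : C(AddCircle (2 * Real.pi), ℂ) := ⟨hper.lift, hG⟩
  have hGc : ∀ x : ℝ, G (x : AddCircle (2 * Real.pi)) = ((f (Real.cos x) : ℝ) : ℂ) := fun x => rfl
  have hfour : ∀ (n : ℤ) (x : ℝ), fourier n (x : AddCircle (2 * Real.pi)) =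
      Complex.exp (n * x * Complex.I) := by
    intro n x
    rw [fourier_coe_apply]
    congr 1
    have : (Real.pi : ℂ) ≠ 0 := by exact_mod_cast Real.pi_ne_zero
    push_cast
    field_simp
  have hcoef : ∀ n : ℤ, fourierCoeff G n = ((1 / Real.pi * cosCoef f n.natAbs : ℝ) : ℂ) := by
    intro n
    rw [fourierCoeff_eq_intervalIntegral _ _ (-Real.pi),
      show -Real.pi + 2 * Real.pi = Real.pi by ring]
    simp only [hGc, hfour]
    have hi : Continuous (fun x : ℝ => Complex.exp (((-n : ℤ) : ℂ) * x * Complex.I) •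
        ((f (Real.cos x) : ℝ) : ℂ)) :=
      Continuous.smul (f := fun x : ℝ => Complex.exp (((-n : ℤ) : ℂ) * x * Complex.I))
        (by fun_prop) (Complex.continuous_ofReal.comp hcf)
    rw [← intervalIntegral.integral_add_adjacent_intervals (b := 0)
      (hi.intervalIntegrable _ _) (hi.intervalIntegrable _ _)]
    have hneg := intervalIntegral.integral_comp_neg (a := 0) (b := Real.pi)
      (fun x : ℝ => Complex.exp (((-n : ℤ) : ℂ) * x * Complex.I) • ((f (Real.cos x) : ℝ) : ℂ))
    rw [neg_zero] at hneg
    have hi2 : Continuous (fun x : ℝ => Complex.exp (((-n : ℤ) : ℂ) * ((-x : ℝ) : ℂ) *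
        Complex.I) • ((f (Real.cos (-x)) : ℝ) : ℂ)) := hi.comp continuous_neg
    rw [← hneg, ← intervalIntegral.integral_add
      (hi2.intervalIntegrable _ _) (hi.intervalIntegrable _ _)]
    have e : ∀ x : ℝ, Complex.exp (((-n : ℤ) : ℂ) * ((-x : ℝ) : ℂ) * Complex.I) •
          ((f (Real.cos (-x)) : ℝ) : ℂ) +
        Complex.exp (((-n : ℤ) : ℂ) * x * Complex.I) • ((f (Real.cos x) : ℝ) : ℂ) =
        ((2 * (f (Real.cos x) * Real.cos (n.natAbs * x)) : ℝ) : ℂ) := by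
      intro x
      have hc : Real.cos (n.natAbs * x) = Real.cos (n * x) := by
        rcases Int.natAbs_eq n with h | h
        · conv_rhs => rw [h]
          simp
        · conv_rhs => rw [h]
          simp
      rw [hc, Real.cos_neg]
      push_cast
      rw [Complex.cos]
      simp only [smul_eq_mul, neg_mul]
      ring_nf
    simp only [e]
    rw [intervalIntegral.integral_ofReal, intervalIntegral.integral_const_mul]
    rw [Complex.real_smul, ← Complex.ofReal_mul, cosCoef]
    congr 1
    field_simp
  have hsum : Summable (fourierCoeff G) := by
    apply Summable.of_nat_of_neg
    · simp only [hcoef, Int.natAbs_natCast]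
      exact Complex.ofRealCLM.summable (hs.mul_left _)
    · simp only [hcoef, Int.natAbs_neg, Int.natAbs_natCast]
      exact Complex.ofRealCLM.summable (hs.mul_left _)
  have h := (has_pointwise_sum_fourier_series_of_summable hsum (θ : AddCircle (2 * Real.pi))).nat_add_neg
  simp only [hcoef, hfour, hGc, Int.natAbs_neg, Int.natAbs_natCast, Int.natAbs_zero] at h
  rw [← Complex.hasSum_ofReal]
  convert h using 1
  · ext n
    push_cast
    rw [Complex.cos]
    simp only [smul_eq_mul, neg_mul]
    ring
  · push_cast
    simp

/-- Chebyshev truncation error bound: if `f` has `k+1` continuous derivatives on `[−1,1]`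
(so that `f, f', …, f^{(k−1)}` are absolutely continuous) and the Chebyshev-weighted
variation `∫_{−1}^1 |f^{(k+1)}(x)|/√(1−x²) dx` is at most `V`, then the degree-`p`
truncated Chebyshev expansion `f̂_p(x) = a₀/2 + ∑_{j=1}^p a_j T_j(x)` with
`a_j = (2/π) ∫_{−1}^1 f(x) T_j(x)/√(1−x²) dx` satisfies, for `p > k`,
`sup_{x ∈ [−1,1]} |f̂_p(x) − f(x)| ≤ 2V/(π k (p−k)^k)`. -/
theorem chebyshev_truncation_error (f : ℝ → ℝ) (k p : ℕ) (hk : 1 ≤ k) (hkp : k < p)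
    (V : ℝ)
    (hsmooth : ContDiffOn ℝ (k + 1) f (Set.Icc (-1 : ℝ) 1))
    (hV : (∫ x in Set.Ioo (-1 : ℝ) 1,
        |iteratedDerivWithin (k + 1) f (Set.Icc (-1 : ℝ) 1) x| / Real.sqrt (1 - x ^ 2)) ≤ V)
    (a : ℕ → ℝ)
    (ha : ∀ j, a j = (2 / Real.pi) *
      ∫ x in Set.Ioo (-1 : ℝ) 1,
        f x * (Chebyshev.T ℝ (j : ℤ)).eval x / Real.sqrt (1 - x ^ 2))
    (fhat : ℝ → ℝ)
    (hfhat : ∀ x, fhat x = a 0 / 2 + ∑ j ∈ Finset.Icc 1 p, a j * (Chebyshev.T ℝ (j : ℤ)).eval x) :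
    ∀ x ∈ Set.Icc (-1 : ℝ) 1,
      |fhat x - f x| ≤ 2 * V / (Real.pi * k * ((p : ℝ) - k) ^ k) := by
  have hu : UniqueDiffOn ℝ (Set.Icc (-1 : ℝ) 1) := uniqueDiffOn_Icc (by norm_num)
  rw [cov (fun x => |iteratedDerivWithin (k + 1) f (Set.Icc (-1 : ℝ) 1) x|)] at hV
  have hsm : ContDiffOn ℝ ((k + 1 : ℕ) : WithTop ℕ∞) f (Set.Icc (-1 : ℝ) 1) := by
    exact_mod_cast hsmooth
  have ha' : ∀ j, a j = (2 / Real.pi) * cosCoef f j := by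
    intro j
    rw [ha, cov (fun x => f x * (Chebyshev.T ℝ (j : ℤ)).eval x), cosCoef]
    simp only [Chebyshev.T_real_cos, Int.cast_natCast]
  have hpi := Real.pi_pos
  have hk0 : (0:ℝ) < k := by exact_mod_cast hk
  have hV0 : 0 ≤ V := le_trans
    (intervalIntegral.integral_nonneg Real.pi_pos.le (fun _ _ => abs_nonneg _)) hV
  have hb : ∀ i : ℕ, |cosCoef f (i + (p + 1))| ≤
      V * (1 / ((i + (p + 1)).descFactorial (k + 1) : ℝ)) := by
    intro i
    refine (cosCoef_bound (k + 1) f hsm _ (by omega)).trans ?_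
    rw [mul_one_div]
    gcongr
  have hpart : ∀ N, ∑ i ∈ Finset.range N, |cosCoef f (i + (p + 1))| ≤
      V * (1 / (k * (p.descFactorial k : ℝ))) := by
    intro N
    refine (Finset.sum_le_sum (fun i _ => hb i)).trans ?_
    rw [← Finset.mul_sum, telescoping k p hk hkp.le]
    refine mul_le_mul_of_nonneg_left ?_ hV0
    have : (0:ℝ) ≤ 1 / (k * ((p + N).descFactorial k : ℝ)) := by positivity
    linarith
  have hsabs : Summable (fun i => |cosCoef f (i + (p + 1))|) :=
    summable_of_sum_range_le (fun _ => abs_nonneg _) hpart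
  have hs : Summable (cosCoef f) := (summable_nat_add_iff (p + 1)).1 hsabs.of_abs
  intro x hx
  obtain ⟨θ, rfl⟩ : ∃ θ, Real.cos θ = x := ⟨Real.arccos x, Real.cos_arccos hx.1 hx.2⟩
  have hsum := cosCoef_hasSum hsm.continuousOn hs θ
  have htail := (hasSum_nat_add_iff' (p + 1)).2 hsum
  have hdiff : f (Real.cos θ) + (1 / Real.pi) * cosCoef f 0 -
      ∑ i ∈ Finset.range (p + 1), (2 / Real.pi) * cosCoef f i * Real.cos (i * θ) =
      -(fhat (Real.cos θ) - f (Real.cos θ)) := by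
    have e : ∑ j ∈ Finset.Icc 1 p, a j * (Chebyshev.T ℝ (j : ℤ)).eval (Real.cos θ) =
        ∑ i ∈ Finset.range p, (2 / Real.pi) * cosCoef f (i + 1) *
          Real.cos (((i + 1 : ℕ) : ℝ) * θ) := by
      rw [Finset.range_eq_Ico, Finset.sum_Ico_add'
        (fun i : ℕ => (2 / Real.pi) * cosCoef f i * Real.cos ((i : ℝ) * θ)) 0 p 1]
      refine Finset.sum_congr ?_ ?_
      · ext j; simp
      · intro j _
        rw [ha', Chebyshev.T_real_cos, Int.cast_natCast]
    rw [hfhat, Finset.sum_range_succ', e, ha']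
    simp
    ring
  rw [hdiff] at htail
  have hterm : ∀ i : ℕ, ‖(2 / Real.pi) * cosCoef f (i + (p + 1)) *
      Real.cos (((i + (p + 1) : ℕ) : ℝ) * θ)‖ ≤ (2 / Real.pi) * |cosCoef f (i + (p + 1))| := by
    intro i
    rw [Real.norm_eq_abs, abs_mul, abs_mul, abs_of_pos (by positivity : 0 < 2 / Real.pi)]
    exact mul_le_of_le_one_right (by positivity) (Real.abs_cos_le_one _)
  have hle := tsum_of_norm_bounded (hsabs.mul_left (2 / Real.pi)).hasSum hterm
  rw [htail.tsum_eq, norm_neg, Real.norm_eq_abs, tsum_mul_left] at hle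
  refine hle.trans ?_
  have ht := Real.tsum_le_of_sum_range_le (fun _ => abs_nonneg _) hpart
  have hpk : (0:ℝ) < (p:ℝ) - k := sub_pos.2 (by exact_mod_cast hkp)
  have hdf : ((p:ℝ) - k) ^ k ≤ (p.descFactorial k : ℝ) := by
    have h1 : (p - k) ^ k ≤ p.descFactorial k :=
      (Nat.pow_le_pow_left (by omega) k).trans (Nat.pow_sub_le_descFactorial p k)
    have h2 : (((p - k : ℕ) : ℝ)) ^ k ≤ (p.descFactorial k : ℝ) := by exact_mod_cast h1
    rwa [Nat.cast_sub hkp.le] at h2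
  calc (2 / Real.pi) * ∑' i, |cosCoef f (i + (p + 1))|
      ≤ (2 / Real.pi) * (V * (1 / (k * ((p:ℝ) - k) ^ k))) := by
        refine mul_le_mul_of_nonneg_left (ht.trans ?_) (by positivity)
        gcongr
    _ = 2 * V / (Real.pi * k * ((p : ℝ) - k) ^ k) := by
        field_simp
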